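/- arXiv:1902.07078 — 2 statements merged into one kernel-verified Lean document; each statement's English description precedes it below -/
import Mathlib

section
/- Let m ∈ (1,2]. For every u ∈ {0,1}^ℕ there exists a unique β > 1 satisfying (β−1)(1+π_β(inf O(u))) = m. If moreover u contains at least two ones, then there exists a unique β ≥ 1 satisfying β·π_β(sup O(u)) = m (where for β = 1 the expression π_1(v) is interpreted as the possibly infinite sum ∑_{k=1}^∞ v_k). -/
/-- `π_β(u)` for a binary sequence `u = u₁u₂⋯` (indexed from 0). -/
noncomputable def piB (β : ℝ) (u : ℕ → Bool) : ℝ :=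
  ∑' k : ℕ, (if u k then (1 : ℝ) else 0) / β ^ (k + 1)

/-- `π_β(u)` for a real digit sequence. -/
noncomputable def piR (β : ℝ) (u : ℕ → ℝ) : ℝ := ∑' k : ℕ, u k / β ^ (k + 1)

/-- A binary sequence viewed as a real digit sequence. -/
def bR (u : ℕ → Bool) : ℕ → ℝ := fun k => if u k then 1 else 0

/-- `U_β(A)`: sequences with digits in `A` whose `π_β`-value has no other expansion over `A`. -/
def Uset (β : ℝ) (A : Set ℝ) : Set (ℕ → ℝ) :=
  {u | (∀ k, u k ∈ A) ∧ ∀ v : ℕ → ℝ, (∀ k, v k ∈ A) → v ≠ u → piR β v ≠ piR β u}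

/-- `𝓛(m) = inf {β > 1 : U_β(m) ∩ {0,1}^ℕ is uncountable}`. -/
noncomputable def Lval (m : ℝ) : ℝ :=
  sInf {β : ℝ | 1 < β ∧ ¬ (Uset β {0, 1, m} ∩ {v | ∃ u : ℕ → Bool, v = bR u}).Countable}

/-- The shift orbit `O(u)` of an infinite binary word. -/
def orbit (u : ℕ → Bool) : Set (ℕ → Bool) := {v | ∃ k : ℕ, v = fun i => u (i + k)}

/-- Suffixes of `u` preceded by the letter `1`. -/
def orbit1 (u : ℕ → Bool) : Set (ℕ → Bool) :=
  {v | ∃ k : ℕ, u k = true ∧ v = fun i => u (i + k + 1)}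

/-- Suffixes of `u` preceded by the letter `0`. -/
def orbit0 (u : ℕ → Bool) : Set (ℕ → Bool) :=
  {v | ∃ k : ℕ, u k = false ∧ v = fun i => u (i + k + 1)}

open Classical in
/-- The lexicographic supremum of a set of binary sequences (greedy construction);
`⊥ = 0̄` for the empty set. -/
noncomputable def lexSupSeq (S : Set (ℕ → Bool)) : ℕ → Bool
  | n => decide (∃ u ∈ S, (∀ i, i < n → u i = lexSupSeq S i) ∧ u n = true)
  termination_by n => n

open Classical in
/-- The lexicographic infimum of a set of binary sequences (greedy construction);
`⊤ = 1̄` for the empty set. -/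
noncomputable def lexInfSeq (S : Set (ℕ → Bool)) : ℕ → Bool
  | n => decide (¬ ∃ u ∈ S, (∀ i, i < n → u i = lexInfSeq S i) ∧ u n = false)
  termination_by n => n

/-- `sup O(u)`, the lexicographically largest limit of suffixes of `u`. -/
noncomputable def supO (u : ℕ → Bool) : ℕ → Bool := lexSupSeq (orbit u)
/-- `inf O(u)`. -/
noncomputable def infO (u : ℕ → Bool) : ℕ → Bool := lexInfSeq (orbit u)
/-- `sup₀(u)`, the supremum of the suffixes preceded by `0`. -/
noncomputable def sup0 (u : ℕ → Bool) : ℕ → Bool := lexSupSeq (orbit0 u)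
/-- `inf₁(u)`, the infimum of the suffixes preceded by `1`. -/
noncomputable def inf1 (u : ℕ → Bool) : ℕ → Bool := lexInfSeq (orbit1 u)

/-- Strict lexicographic order on infinite binary words. -/
def lexLt (u v : ℕ → Bool) : Prop := ∃ n, (∀ i, i < n → u i = v i) ∧ u n < v n
/-- Lexicographic order on infinite binary words. -/
def lexLe (u v : ℕ → Bool) : Prop := lexLt u v ∨ u = v

/-- `f_u(m)`: the unique `β ≥ 1` with `β·π_β(sup O(u)) = m`. -/
noncomputable def fVal (u : ℕ → Bool) (m : ℝ) : ℝ :=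
  sInf {β : ℝ | 1 ≤ β ∧ β * piB β (supO u) = m}

/-- `g_u(m)`: the unique `β > 1` with `(β-1)(1+π_β(inf O(u))) = m`. -/
noncomputable def gVal (u : ℕ → Bool) (m : ℝ) : ℝ :=
  sInf {β : ℝ | 1 < β ∧ (β - 1) * (1 + piB β (infO u)) = m}

/-- `μ_u`: the unique `m ∈ (1,2]` with `f_u(m) = g_u(m)`. -/
noncomputable def muVal (u : ℕ → Bool) : ℝ :=
  sInf {m : ℝ | 1 < m ∧ m ≤ 2 ∧ fVal u m = gVal u m}

/-- `u` contains at least two ones. -/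
def TwoOnes (u : ℕ → Bool) : Prop := ∃ k l, k < l ∧ u k = true ∧ u l = true

/-- The substitution `L : 0 ↦ 0, 1 ↦ 01` (with `0 = false`, `1 = true`). -/
def Lsub : Bool → List Bool := fun b => if b then [false, true] else [false]
/-- The substitution `M : 0 ↦ 01, 1 ↦ 10`. -/
def Msub : Bool → List Bool := fun b => if b then [true, false] else [false, true]
/-- The substitution `R : 0 ↦ 01, 1 ↦ 1`. -/
def Rsub : Bool → List Bool := fun b => if b then [true] else [false, true]
/-- The identity substitution. -/
def idSub : Bool → List Bool := fun b => [b]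
/-- Composition of substitutions: `compSub σ τ = σ ∘ τ` (apply `τ` first). -/
def compSub (σ τ : Bool → List Bool) : Bool → List Bool := fun b => (τ b).flatMap σ

/-- The monoid `{L,M,R}*` generated by the three substitutions. -/
def LMRstar : Set (Bool → List Bool) :=
  {σ | ∃ l : List (Bool → List Bool),
    (∀ τ ∈ l, τ = Lsub ∨ τ = Msub ∨ τ = Rsub) ∧ σ = l.foldr compSub idSub}

/-- A substitution applied to an infinite word, `σ(u₁)σ(u₂)⋯`. -/
noncomputable def substApply (σ : Bool → List Bool) (u : ℕ → Bool) : ℕ → Bool := fun n =>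
  let k := sSup {k : ℕ | (∑ i ∈ Finset.range k, (σ (u i)).length) ≤ n}
  (σ (u k)).getD (n - ∑ i ∈ Finset.range k, (σ (u i)).length) false

/-- `u` is a limit word of the sequence of substitutions `σseq`. -/
def IsLimitWord (σseq : ℕ → Bool → List Bool) (u : ℕ → Bool) : Prop :=
  ∃ useq : ℕ → ℕ → Bool, useq 0 = u ∧ ∀ n, useq n = substApply (σseq n) (useq (n + 1))

/-- Primitivity of a sequence of substitutions in `{L,M,R}^ℕ`: no tail is constantly `L`
and no tail is constantly `R`. -/
def PrimitiveSeq (σseq : ℕ → Bool → List Bool) : Prop :=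
  (¬ ∃ k, ∀ n, k ≤ n → σseq n = Lsub) ∧ ¬ ∃ k, ∀ n, k ≤ n → σseq n = Rsub

/-- `S_{L,M,R}`: the set of limit words of primitive sequences of substitutions. -/
def Sset : Set (ℕ → Bool) :=
  {u | ∃ σseq : ℕ → Bool → List Bool,
    (∀ n, σseq n = Lsub ∨ σseq n = Msub ∨ σseq n = Rsub) ∧
    PrimitiveSeq σseq ∧ IsLimitWord σseq u}

/-- The word `1 0̄ = 1000⋯`. -/
def w10bar : ℕ → Bool := fun n => decide (n = 0)
/-- The word `0 1̄ = 0111⋯`. -/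
def w01bar : ℕ → Bool := fun n => decide (n ≠ 0)
/-- The word `01 0̄ = 01000⋯`. -/
def w010bar : ℕ → Bool := fun n => decide (n = 1)
/-- The word `10 1̄ = 10111⋯`. -/
def w101bar : ℕ → Bool := fun n => decide (n ≠ 1)
/-- The word `0̄`. -/
def w0bar : ℕ → Bool := fun _ => false
/-- The word `1̄`. -/
def w1bar : ℕ → Bool := fun _ => true

/-- Prepend a letter to an infinite word. -/
def consB (b : Bool) (u : ℕ → Bool) : ℕ → Bool := fun n =>
  match n with
  | 0 => b
  | Nat.succ k => u k

/-- Prepend a finite word to an infinite word. -/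
def appendW (w : List Bool) (v : ℕ → Bool) : ℕ → Bool := fun n =>
  if n < w.length then w.getD n false else v (n - w.length)

lemma digit_mem_Icc (u : ℕ → Bool) (k : ℕ) :
    0 ≤ (if u k then (1 : ℝ) else 0) ∧ (if u k then (1 : ℝ) else 0) ≤ 1 := by
  split_ifs <;> norm_num

lemma hasSum_one_div_pow_succ {β : ℝ} (hβ : 1 < β) :
    HasSum (fun k : ℕ => 1 / β ^ (k + 1)) (1 / (β - 1)) := by
  have h0 : 0 < β := by linarith
  have h := (hasSum_geometric_of_lt_one (inv_nonneg.2 h0.le) (inv_lt_one_of_one_lt₀ hβ)).mul_left β⁻¹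
  have hf : (fun k : ℕ => 1 / β ^ (k + 1)) = fun k => β⁻¹ * β⁻¹ ^ k := by
    funext k
    rw [one_div, ← inv_pow, pow_succ']
  have hv : 1 / (β - 1) = β⁻¹ * (1 - β⁻¹)⁻¹ := by
    rw [← mul_inv, mul_sub, mul_inv_cancel₀ h0.ne', mul_one, one_div]
  rw [hf, hv]
  exact h

lemma summable_piB {β : ℝ} (hβ : 1 < β) (u : ℕ → Bool) :
    Summable fun k : ℕ => (if u k then (1 : ℝ) else 0) / β ^ (k + 1) := by
  have h0 : 0 < β := by linarith
  refine Summable.of_nonneg_of_le (fun k => ?_) (fun k => ?_) (hasSum_one_div_pow_succ hβ).summable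
  · have := (digit_mem_Icc u k).1
    positivity
  · have := (digit_mem_Icc u k).2
    gcongr

lemma piB_le {β : ℝ} (hβ : 1 < β) (u : ℕ → Bool) : piB β u ≤ 1 / (β - 1) := by
  have h0 : 0 < β := by linarith
  rw [← (hasSum_one_div_pow_succ hβ).tsum_eq]
  refine (summable_piB hβ u).tsum_le_tsum (fun k => ?_) (hasSum_one_div_pow_succ hβ).summable
  have := (digit_mem_Icc u k).2
  gcongr

lemma piB_nonneg {β : ℝ} (hβ : 0 ≤ β) (u : ℕ → Bool) : 0 ≤ piB β u := by
  refine tsum_nonneg fun k => ?_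
  have := (digit_mem_Icc u k).1
  positivity

lemma piB_antitoneOn (u : ℕ → Bool) : AntitoneOn (fun β => piB β u) (Set.Ioi 1) := by
  intro β hβ γ hγ h
  have h0 : (0 : ℝ) < β := zero_lt_one.trans hβ
  refine (summable_piB hγ u).tsum_le_tsum (fun k => ?_) (summable_piB hβ u)
  have := (digit_mem_Icc u k).1
  gcongr

/-- Flipping all digits of `u` replaces `π_β(u)` by `1 / (β - 1) - π_β(u)`. -/
lemma piB_add_piB_not {β : ℝ} (hβ : 1 < β) (u : ℕ → Bool) :
    piB β u + piB β (fun k => !u k) = 1 / (β - 1) := by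
  rw [piB, piB, ← (summable_piB hβ u).tsum_add (summable_piB hβ _),
    ← (hasSum_one_div_pow_succ hβ).tsum_eq]
  congr 1
  funext k
  cases u k <;> simp

lemma continuousOn_piB {a : ℝ} (ha : 0 < a) (u : ℕ → Bool)
    (hs : Summable fun k : ℕ => (if u k then (1 : ℝ) else 0) / a ^ (k + 1)) :
    ContinuousOn (fun β => piB β u) (Set.Ici a) := by
  refine continuousOn_tsum (fun k => ?_) hs (fun k β hβ => ?_)
  · refine continuousOn_const.div (by fun_prop) fun β hβ => ?_
    exact (pow_pos (ha.trans_le hβ) _).ne'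
  · have hβ' : a ≤ β := hβ
    have h0 : 0 < β := ha.trans_le hβ
    have := (digit_mem_Icc u k).1
    rw [Real.norm_of_nonneg (by positivity)]
    gcongr

lemma sub_one_mul_one_add_piB {β : ℝ} (hβ : 1 < β) (w : ℕ → Bool) :
    (β - 1) * (1 + piB β w) = 1 + (β - 1) * (1 - piB β (fun k => !w k)) := by
  have h : β - 1 ≠ 0 := by linarith
  rw [eq_sub_of_add_eq (piB_add_piB_not hβ w)]
  field_simp
  ring

theorem existsUnique_sub_one_mul_one_add_piB {m : ℝ} (hm : 1 < m) (w : ℕ → Bool) :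
    ∃! β : ℝ, 1 < β ∧ (β - 1) * (1 + piB β w) = m := by
  have hlt : ∀ β γ : ℝ, 1 < β → β < γ → (β - 1) * (1 + piB β w) = m →
      (γ - 1) * (1 + piB γ w) ≠ m := by
    intro β γ hβ h h1 h2
    have hγ := hβ.trans h
    rw [sub_one_mul_one_add_piB hβ] at h1
    rw [sub_one_mul_one_add_piB hγ] at h2
    have hanti : piB γ (fun k => !w k) ≤ piB β (fun k => !w k) :=
      piB_antitoneOn _ hβ hγ h.le
    have hpos : 0 < 1 - piB β (fun k => !w k) := by
      by_contra! hle
      nlinarith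
    nlinarith
  have hex : ∃ β : ℝ, 1 < β ∧ (β - 1) * (1 + piB β w) = m := by
    have hc : ContinuousOn (fun β => (β - 1) * (1 + piB β w)) (Set.Icc m (m + 1)) := by
      have := (continuousOn_piB (zero_lt_one.trans hm) w (summable_piB hm w)).mono
        (Set.Icc_subset_Ici_self : Set.Icc m (m + 1) ⊆ Set.Ici m)
      fun_prop
    have hmem : m ∈ Set.Icc ((m - 1) * (1 + piB m w)) ((m + 1 - 1) * (1 + piB (m + 1) w)) := by
      constructor
      · rw [sub_one_mul_one_add_piB hm]
        nlinarith [piB_nonneg (zero_lt_one.trans hm).le (fun k => !w k)]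
      · nlinarith [piB_nonneg (by linarith : 0 ≤ m + 1) w]
    obtain ⟨β, hβ, h⟩ := intermediate_value_Icc (by linarith) hc hmem
    exact ⟨β, hm.trans_le hβ.1, h⟩
  obtain ⟨β, hβ, h⟩ := hex
  refine ⟨β, ⟨hβ, h⟩, fun γ hγ => ?_⟩
  rcases lt_trichotomy γ β with hlt' | heq | hlt'
  · exact absurd h (hlt γ β hγ.1 hlt' hγ.2)
  · exact heq
  · exact absurd hγ.2 (hlt β γ hβ hlt' h)

lemma mul_piB (β : ℝ) (hβ : 0 < β) (v : ℕ → Bool) :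
    β * piB β v = ∑' k : ℕ, (if v k then (1 : ℝ) else 0) / β ^ k := by
  rw [piB, ← tsum_mul_left]
  congr 1
  funext k
  field_simp
  ring

lemma summable_digit_div_pow {β : ℝ} (hβ : 0 < β) (v : ℕ → Bool)
    (hs : Summable fun k : ℕ => (if v k then (1 : ℝ) else 0) / β ^ (k + 1)) :
    Summable fun k : ℕ => (if v k then (1 : ℝ) else 0) / β ^ k := by
  refine (hs.mul_left β).congr fun k => ?_
  field_simp
  ring

lemma mul_piB_lt {β γ : ℝ} (hβ : 1 ≤ β) (h : β < γ) (v : ℕ → Bool) {j : ℕ} (hj : 0 < j)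
    (hvj : v j = true)
    (hs : Summable fun k : ℕ => (if v k then (1 : ℝ) else 0) / β ^ (k + 1)) :
    γ * piB γ v < β * piB β v := by
  have hβ0 : 0 < β := by linarith
  have hγ0 : 0 < γ := by linarith
  rw [mul_piB β hβ0, mul_piB γ hγ0]
  refine Summable.tsum_lt_tsum (i := j) (fun k => ?_) ?_
    (summable_digit_div_pow hγ0 v (summable_piB (hβ.trans_lt h) v))
    (summable_digit_div_pow hβ0 v hs)
  · have := (digit_mem_Icc v k).1
    gcongr
  · simp only [hvj, if_true]
    have := pow_lt_pow_left₀ h hβ0.le hj.ne'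
    gcongr

theorem existsUnique_mul_piB {m : ℝ} (hm : m ∈ Set.Ioc (1 : ℝ) 2) {v : ℕ → Bool}
    (h0 : v 0 = true) {j : ℕ} (hj : 0 < j) (hvj : v j = true) :
    ∃! β : ℝ, 1 ≤ β ∧ β * piB β v = m := by
  obtain ⟨hm1, hm2⟩ := hm
  have hsum : ∀ β : ℝ, β * piB β v = m →
      Summable fun k : ℕ => (if v k then (1 : ℝ) else 0) / β ^ (k + 1) := by
    intro β h
    by_contra hs
    rw [piB, tsum_eq_zero_of_not_summable hs] at h
    linarith
  have hex : ∃ β : ℝ, 1 ≤ β ∧ β * piB β v = m := by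
    have hm1' : 0 < m - 1 := by linarith
    have hB : 1 < 1 + 1 / (m - 1) := by
      have : 0 < 1 / (m - 1) := by positivity
      linarith
    set B := 1 + 1 / (m - 1) with hBdef
    have hBle : B * piB B v ≤ m := by
      have h1 := piB_le hB v
      have h2 : 1 / (B - 1) = m - 1 := by rw [hBdef]; simp
      rw [h2] at h1
      calc B * piB B v ≤ B * (m - 1) := by gcongr
        _ = m := by rw [hBdef]; field_simp; ring
    obtain ⟨a, ha1, haB, hs, ham⟩ : ∃ a : ℝ, 1 ≤ a ∧ a ≤ B ∧
        (Summable fun k : ℕ => (if v k then (1 : ℝ) else 0) / a ^ (k + 1)) ∧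
        m ≤ a * piB a v := by
      by_cases hs : Summable fun k : ℕ => (if v k then (1 : ℝ) else 0) / (1 : ℝ) ^ (k + 1)
      · refine ⟨1, le_rfl, hB.le, hs, hm2.trans ?_⟩
        rw [one_mul]
        refine le_trans ?_ (hs.sum_le_tsum {0, j} fun k _ => ?_)
        · rw [Finset.sum_pair hj.ne]
          norm_num [h0, hvj]
        · have := (digit_mem_Icc v k).1
          positivity
      · have ht := (not_summable_iff_tendsto_nat_atTop_of_nonneg
          (fun k => div_nonneg (digit_mem_Icc v k).1 (by positivity))).1 hs
        obtain ⟨n, hn⟩ := (ht.eventually_gt_atTop 2).exists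
        have hc : ContinuousAt (fun β : ℝ => β * ∑ k ∈ Finset.range n,
            (if v k then (1 : ℝ) else 0) / β ^ (k + 1)) 1 := by
          refine continuousAt_id.mul (tendsto_finsetSum _ fun k _ => ?_)
          exact continuousAt_const.div (by fun_prop) (by simp)
        have hev := hc.eventually_const_lt (u := 2) (by simpa using hn)
        obtain ⟨a, ⟨ha2, haB⟩, ha1⟩ :=
          (((hev.and (eventually_lt_nhds hB)).filter_mono nhdsWithin_le_nhds).and
            (self_mem_nhdsWithin (s := Set.Ioi (1 : ℝ)))).exists
        have ha1' : 1 < a := ha1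
        have ha0 : 0 < a := by linarith
        refine ⟨a, ha1'.le, haB.le, summable_piB ha1' v, hm2.trans (ha2.le.trans ?_)⟩
        gcongr
        refine (summable_piB ha1' v).sum_le_tsum _ fun k _ => ?_
        have := (digit_mem_Icc v k).1
        positivity
    have hc : ContinuousOn (fun β => β * piB β v) (Set.Icc a B) :=
      continuousOn_id.mul ((continuousOn_piB (by linarith) v hs).mono Set.Icc_subset_Ici_self)
    obtain ⟨β, hβ, h⟩ := intermediate_value_Icc' haB hc ⟨hBle, ham⟩
    exact ⟨β, ha1.trans hβ.1, h⟩
  obtain ⟨β, hβ, h⟩ := hex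
  refine ⟨β, ⟨hβ, h⟩, fun γ ⟨hγ, h'⟩ => ?_⟩
  rcases lt_trichotomy γ β with hlt | heq | hlt
  · have := mul_piB_lt hγ hlt v hj hvj (hsum γ h')
    linarith
  · exact heq
  · have := mul_piB_lt hβ hlt v hj hvj (hsum β h)
    linarith

lemma lexSupSeq_eq_true {S : Set (ℕ → Bool)} {n : ℕ} {w : ℕ → Bool} (hw : w ∈ S)
    (hpre : ∀ i, i < n → w i = lexSupSeq S i) (hn : w n = true) : lexSupSeq S n = true := by
  rw [lexSupSeq]
  simp only [decide_eq_true_eq]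
  exact ⟨w, hw, hpre, hn⟩

lemma supO_zero {u : ℕ → Bool} {k : ℕ} (hk : u k = true) : supO u 0 = true :=
  lexSupSeq_eq_true (w := fun i => u (i + k)) ⟨k, rfl⟩ (by simp) (by simpa using hk)

lemma TwoOnes.exists_supO_eq_true {u : ℕ → Bool} (h : TwoOnes u) :
    ∃ j, 0 < j ∧ supO u j = true := by
  obtain ⟨k, l, hkl, hk, hl⟩ := h
  have hex : ∃ j, 0 < j ∧ u (j + k) = true :=
    ⟨l - k, by omega, by rwa [Nat.sub_add_cancel hkl.le]⟩
  by_contra! hno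
  obtain ⟨hj, huj⟩ := Nat.find_spec hex
  refine hno _ hj (lexSupSeq_eq_true (w := fun i => u (i + k)) ⟨k, rfl⟩ (fun i hi => ?_) huj)
  change u (i + k) = supO u i
  rcases Nat.eq_zero_or_pos i with rfl | hi0
  · rw [supO_zero hk, Nat.zero_add, hk]
  · have h1 := Nat.find_min hex hi
    have h2 := hno i hi0
    simp only [hi0, true_and, Bool.not_eq_true] at h1 h2
    rw [h1, h2]

/-- `g_u(m)` is well defined for every binary `u`, and `f_u(m)` is well defined when `u`
contains at least two ones. -/
theorem g_and_f_well_defined (m : ℝ) (hm : m ∈ Set.Ioc (1 : ℝ) 2) (u : ℕ → Bool) :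
    (∃! β : ℝ, 1 < β ∧ (β - 1) * (1 + piB β (infO u)) = m) ∧
    (TwoOnes u → ∃! β : ℝ, 1 ≤ β ∧ β * piB β (supO u) = m) := by
  refine ⟨existsUnique_sub_one_mul_one_add_piB hm.1 _, fun h => ?_⟩
  obtain ⟨j, hj, hvj⟩ := h.exists_supO_eq_true
  obtain ⟨k, -, -, hk, -⟩ := h
  exact existsUnique_mul_piB hm (supO_zero hk) hj hvj
end

section
/- For all u ∈ {0,1}^ℕ: inf O(L(u)) = L(inf O(u)), inf O(R(u)) = R(inf O(u)), and L(sup O(u)) equals the letter 0 followed by sup O(L(u)). If inf O(u) = inf₁(u), then inf O(M(u)) equals the letter 0 followed by M(inf O(u)). If sup O(u) = sup₀(u), then sup O(R(u)) equals the letter 1 followed by R(sup O(u)), and sup O(M(u)) equals the letter 1 followed by M(sup O(u)). -/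
/-- The suffix of `u` starting at position `k`. -/
def suffix (k : ℕ) (u : ℕ → Bool) : ℕ → Bool := fun i => u (i + k)

lemma suffix_zero (u : ℕ → Bool) : suffix 0 u = u := rfl

lemma suffix_suffix (k l : ℕ) (u : ℕ → Bool) : suffix k (suffix l u) = suffix (l + k) u := by
  funext i
  simp [suffix, add_comm, add_left_comm]

lemma suffix_one_suffix (k : ℕ) (u : ℕ → Bool) : suffix 1 (suffix k u) = suffix (k + 1) u :=
  suffix_suffix 1 k u

lemma suffix_apply_zero (k : ℕ) (u : ℕ → Bool) : suffix k u 0 = u k := by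
  simp [suffix]

lemma consB_suffix_one {b : Bool} {u : ℕ → Bool} (h : u 0 = b) : consB b (suffix 1 u) = u := by
  funext n
  cases n with
  | zero => exact h.symm
  | succ n => rfl

lemma suffix_mem_orbit (k : ℕ) (u : ℕ → Bool) : suffix k u ∈ orbit u := ⟨k, rfl⟩

lemma orbit_nonempty (u : ℕ → Bool) : (orbit u).Nonempty := ⟨_, suffix_mem_orbit 0 u⟩

/-! ### Lexicographic order -/

lemma lexLe_of_head {u v : ℕ → Bool} (hu : u 0 = false) (hv : v 0 = true) : lexLe u v :=
  Or.inl ⟨0, by simp, by simp [hu, hv]⟩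

lemma lexLe.consB {u v : ℕ → Bool} (b : Bool) (h : lexLe u v) :
    lexLe (consB b u) (consB b v) := by
  rcases h with ⟨n, hn, hlt⟩ | rfl
  · refine Or.inl ⟨n + 1, fun i hi => ?_, hlt⟩
    cases i with
    | zero => rfl
    | succ i => exact hn i (by omega)
  · exact Or.inr rfl

lemma lexLe.head_le {u v : ℕ → Bool} (h : lexLe u v) : u 0 ≤ v 0 := by
  rcases h with ⟨n, hn, hlt⟩ | rfl
  · rcases Nat.eq_zero_or_pos n with rfl | hpos
    · exact hlt.le
    · exact (hn 0 hpos).le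
  · exact le_rfl

lemma lexLe.suffix_one {u v : ℕ → Bool} (h : lexLe u v) (h0 : u 0 = v 0) :
    lexLe (suffix 1 u) (suffix 1 v) := by
  rcases h with ⟨n, hn, hlt⟩ | rfl
  · cases n with
    | zero => simp [h0] at hlt
    | succ n => exact Or.inl ⟨n, fun i hi => hn (i + 1) (by omega), hlt⟩
  · exact Or.inr rfl

lemma consB_agree {u v : ℕ → Bool} {n : ℕ} (b : Bool) (h : ∀ i < n, u i = v i) :
    ∀ i < n, consB b u i = consB b v i := by
  intro i hi
  cases i with
  | zero => rfl
  | succ i => exact h i (by omega)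

lemma exists_first_ne {u v : ℕ → Bool} (h : u ≠ v) : ∃ n, (∀ i < n, u i = v i) ∧ u n ≠ v n := by
  classical
  have hex : ∃ n, u n ≠ v n := Function.ne_iff.mp h
  exact ⟨Nat.find hex, fun i hi => not_not.mp (Nat.find_min hex hi), Nat.find_spec hex⟩

lemma not_lexLe_of_agree {u v : ℕ → Bool} {n : ℕ} (h : ∀ i < n, u i = v i) (hu : u n = true)
    (hv : v n = false) : ¬ lexLe u v := by
  rintro (⟨m, hm, hlt⟩ | rfl)
  · rcases lt_trichotomy m n with hmn | rfl | hmn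
    · simp [h m hmn] at hlt
    · simp [hu, Bool.lt_iff] at hlt
    · simpa [hu, hv] using hm n hmn
  · simp [hu] at hv

/-! ### Suprema and infima -/

lemma lexSupSeq_eq_true_iff (S : Set (ℕ → Bool)) (n : ℕ) :
    lexSupSeq S n = true ↔ ∃ u ∈ S, (∀ i, i < n → u i = lexSupSeq S i) ∧ u n = true := by
  rw [lexSupSeq]
  simp

lemma lexInfSeq_eq_false_iff (S : Set (ℕ → Bool)) (n : ℕ) :
    lexInfSeq S n = false ↔ ∃ u ∈ S, (∀ i, i < n → u i = lexInfSeq S i) ∧ u n = false := by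
  rw [lexInfSeq]
  simp

lemma exists_agree_lexSupSeq {S : Set (ℕ → Bool)} (hS : S.Nonempty) (n : ℕ) :
    ∃ v ∈ S, ∀ i < n, v i = lexSupSeq S i := by
  induction n with
  | zero =>
    obtain ⟨v, hv⟩ := hS
    exact ⟨v, hv, by simp⟩
  | succ n ih =>
    cases hn : lexSupSeq S n with
    | true =>
      obtain ⟨v, hv, h, hvn⟩ := (lexSupSeq_eq_true_iff S n).mp hn
      refine ⟨v, hv, fun i hi => ?_⟩
      rcases Nat.lt_succ_iff_lt_or_eq.mp hi with hi | rfl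
      · exact h i hi
      · rw [hvn, hn]
    | false =>
      obtain ⟨v, hv, h⟩ := ih
      refine ⟨v, hv, fun i hi => ?_⟩
      rcases Nat.lt_succ_iff_lt_or_eq.mp hi with hi | rfl
      · exact h i hi
      · rw [hn, ← Bool.not_eq_true]
        intro hvn
        simp [(lexSupSeq_eq_true_iff S i).mpr ⟨v, hv, h, hvn⟩] at hn

lemma exists_agree_lexInfSeq {S : Set (ℕ → Bool)} (hS : S.Nonempty) (n : ℕ) :
    ∃ v ∈ S, ∀ i < n, v i = lexInfSeq S i := by
  induction n with
  | zero =>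
    obtain ⟨v, hv⟩ := hS
    exact ⟨v, hv, by simp⟩
  | succ n ih =>
    cases hn : lexInfSeq S n with
    | false =>
      obtain ⟨v, hv, h, hvn⟩ := (lexInfSeq_eq_false_iff S n).mp hn
      refine ⟨v, hv, fun i hi => ?_⟩
      rcases Nat.lt_succ_iff_lt_or_eq.mp hi with hi | rfl
      · exact h i hi
      · rw [hvn, hn]
    | true =>
      obtain ⟨v, hv, h⟩ := ih
      refine ⟨v, hv, fun i hi => ?_⟩
      rcases Nat.lt_succ_iff_lt_or_eq.mp hi with hi | rfl
      · exact h i hi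
      · rw [hn, ← Bool.not_eq_false]
        intro hvn
        simp [(lexInfSeq_eq_false_iff S i).mpr ⟨v, hv, h, hvn⟩] at hn

lemma lexLe_lexSupSeq {S : Set (ℕ → Bool)} {v : ℕ → Bool} (hv : v ∈ S) :
    lexLe v (lexSupSeq S) := by
  by_cases heq : v = lexSupSeq S
  · exact Or.inr heq
  obtain ⟨n, hn, hne⟩ := exists_first_ne heq
  refine Or.inl ⟨n, hn, ?_⟩
  cases hvn : v n with
  | false => exact Bool.lt_iff.mpr ⟨rfl, by simpa [hvn] using hne.symm⟩
  | true => exact absurd (hvn.trans ((lexSupSeq_eq_true_iff S n).mpr ⟨v, hv, hn, hvn⟩).symm) hne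

lemma lexInfSeq_lexLe {S : Set (ℕ → Bool)} {v : ℕ → Bool} (hv : v ∈ S) :
    lexLe (lexInfSeq S) v := by
  by_cases heq : v = lexInfSeq S
  · exact Or.inr heq.symm
  obtain ⟨n, hn, hne⟩ := exists_first_ne heq
  refine Or.inl ⟨n, fun i hi => (hn i hi).symm, ?_⟩
  cases hvn : v n with
  | true => exact Bool.lt_iff.mpr ⟨by simpa [hvn] using hne.symm, rfl⟩
  | false => exact absurd (hvn.trans ((lexInfSeq_eq_false_iff S n).mpr ⟨v, hv, hn, hvn⟩).symm) hne

lemma lexSupSeq_eq {S : Set (ℕ → Bool)} {w : ℕ → Bool} (hub : ∀ v ∈ S, lexLe v w)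
    (happ : ∀ n, ∃ v ∈ S, ∀ i < n, v i = w i) : lexSupSeq S = w := by
  by_contra hne
  obtain ⟨n, hn, hne⟩ := exists_first_ne hne
  cases hs : lexSupSeq S n with
  | true =>
    obtain ⟨v, hv, h, hvn⟩ := (lexSupSeq_eq_true_iff S n).mp hs
    rw [hs] at hne
    exact not_lexLe_of_agree (fun i hi => (h i hi).trans (hn i hi)) hvn (by simpa using hne.symm)
      (hub v hv)
  | false =>
    obtain ⟨v, hv, h⟩ := happ (n + 1)
    have hvn : v n = true := by
      rw [h n (by omega)]
      rw [hs] at hne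
      simpa using hne.symm
    have := (lexSupSeq_eq_true_iff S n).mpr
      ⟨v, hv, fun i hi => (h i (by omega)).trans (hn i hi).symm, hvn⟩
    simp [hs] at this

lemma lexInfSeq_eq {S : Set (ℕ → Bool)} {w : ℕ → Bool} (hlb : ∀ v ∈ S, lexLe w v)
    (happ : ∀ n, ∃ v ∈ S, ∀ i < n, v i = w i) : lexInfSeq S = w := by
  by_contra hne
  obtain ⟨n, hn, hne⟩ := exists_first_ne hne
  cases hs : lexInfSeq S n with
  | false =>
    obtain ⟨v, hv, h, hvn⟩ := (lexInfSeq_eq_false_iff S n).mp hs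
    rw [hs] at hne
    exact not_lexLe_of_agree (fun i hi => ((h i hi).trans (hn i hi)).symm)
      (by simpa using hne.symm) hvn (hlb v hv)
  | true =>
    obtain ⟨v, hv, h⟩ := happ (n + 1)
    have hvn : v n = false := by
      rw [h n (by omega)]
      rw [hs] at hne
      simpa using hne.symm
    have := (lexInfSeq_eq_false_iff S n).mpr
      ⟨v, hv, fun i hi => (h i (by omega)).trans (hn i hi).symm, hvn⟩
    simp [hs] at this

lemma suffix_lexLe_supO (k : ℕ) (u : ℕ → Bool) : lexLe (suffix k u) (supO u) :=
  lexLe_lexSupSeq (suffix_mem_orbit k u)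

lemma infO_lexLe_suffix (k : ℕ) (u : ℕ → Bool) : lexLe (infO u) (suffix k u) :=
  lexInfSeq_lexLe (suffix_mem_orbit k u)

lemma exists_suffix_agree_supO (u : ℕ → Bool) (n : ℕ) :
    ∃ k, ∀ i < n, suffix k u i = supO u i := by
  obtain ⟨_, ⟨k, rfl⟩, h⟩ := exists_agree_lexSupSeq (orbit_nonempty u) n
  exact ⟨k, h⟩

lemma exists_suffix_agree_infO (u : ℕ → Bool) (n : ℕ) :
    ∃ k, ∀ i < n, suffix k u i = infO u i := by
  obtain ⟨_, ⟨k, rfl⟩, h⟩ := exists_agree_lexInfSeq (orbit_nonempty u) n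
  exact ⟨k, h⟩

lemma supO_zero_of_apply {u : ℕ → Bool} {k : ℕ} (h : u k = true) : supO u 0 = true :=
  Bool.eq_true_of_true_le (by
    simpa [suffix_apply_zero, h] using (suffix_lexLe_supO k u).head_le)

lemma infO_zero_of_apply {u : ℕ → Bool} {k : ℕ} (h : u k = false) : infO u 0 = false :=
  Bool.eq_false_of_le_false (by
    simpa [suffix_apply_zero, h] using (infO_lexLe_suffix k u).head_le)

lemma orbit0_nonempty_of_supO_eq {u : ℕ → Bool} (h : supO u = sup0 u) : (orbit0 u).Nonempty := by
  by_contra hne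
  have hu : u 0 = true := by
    rw [← Bool.not_eq_false]
    exact fun h0 => hne ⟨_, 0, h0, rfl⟩
  have h0 : sup0 u 0 = true := h ▸ supO_zero_of_apply hu
  obtain ⟨v, hv, -⟩ := (lexSupSeq_eq_true_iff _ _).mp h0
  exact hne ⟨v, hv⟩

lemma orbit1_nonempty_of_infO_eq {u : ℕ → Bool} (h : infO u = inf1 u) : (orbit1 u).Nonempty := by
  by_contra hne
  have hu : u 0 = false := by
    rw [← Bool.not_eq_true]
    exact fun h0 => hne ⟨_, 0, h0, rfl⟩
  have h0 : inf1 u 0 = false := h ▸ infO_zero_of_apply hu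
  obtain ⟨v, hv, -⟩ := (lexInfSeq_eq_false_iff _ _).mp h0
  exact hne ⟨v, hv⟩

lemma exists_suffix_agree_of_supO_eq {u : ℕ → Bool} (h : supO u = sup0 u) (n : ℕ) :
    ∃ k, u k = false ∧ ∀ i < n, suffix (k + 1) u i = supO u i := by
  obtain ⟨_, ⟨k, hk, rfl⟩, hv⟩ := exists_agree_lexSupSeq (orbit0_nonempty_of_supO_eq h) n
  exact ⟨k, hk, h ▸ hv⟩

lemma exists_suffix_agree_of_infO_eq {u : ℕ → Bool} (h : infO u = inf1 u) (n : ℕ) :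
    ∃ k, u k = true ∧ ∀ i < n, suffix (k + 1) u i = infO u i := by
  obtain ⟨_, ⟨k, hk, rfl⟩, hv⟩ := exists_agree_lexInfSeq (orbit1_nonempty_of_infO_eq h) n
  exact ⟨k, hk, h ▸ hv⟩

/-! ### Substitutions on infinite words -/

lemma substApply_sum_add (σ : Bool → List Bool) (u : ℕ → Bool) (k j : ℕ)
    (hj : j < (σ (u k)).length) :
    substApply σ u ((∑ i ∈ Finset.range k, (σ (u i)).length) + j) = (σ (u k)).getD j false := by
  have hsup : sSup {l : ℕ | (∑ i ∈ Finset.range l, (σ (u i)).length) ≤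
      (∑ i ∈ Finset.range k, (σ (u i)).length) + j} = k := by
    refine IsGreatest.csSup_eq ⟨by simp, fun l hl => ?_⟩
    by_contra! hlk
    have hmono : ∑ i ∈ Finset.range (k + 1), (σ (u i)).length ≤
        ∑ i ∈ Finset.range l, (σ (u i)).length :=
      Finset.sum_le_sum_of_subset (Finset.range_mono hlk)
    rw [Finset.sum_range_succ] at hmono
    have hl' : (∑ i ∈ Finset.range l, (σ (u i)).length) ≤
      (∑ i ∈ Finset.range k, (σ (u i)).length) + j := hl
    omega
  simp only [substApply]
  rw [hsup, Nat.add_sub_cancel_left]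

lemma exists_eq_sum_add {σ : Bool → List Bool} (hσ : ∀ b, σ b ≠ []) (u : ℕ → Bool) (n : ℕ) :
    ∃ k j, j < (σ (u k)).length ∧ n = (∑ i ∈ Finset.range k, (σ (u i)).length) + j := by
  induction n with
  | zero => exact ⟨0, 0, List.length_pos_iff.mpr (hσ _), by simp⟩
  | succ n ih =>
    obtain ⟨k, j, hj, hn⟩ := ih
    by_cases hj' : j + 1 < (σ (u k)).length
    · exact ⟨k, j + 1, hj', by omega⟩
    · refine ⟨k + 1, 0, List.length_pos_iff.mpr (hσ _), ?_⟩
      rw [Finset.sum_range_succ]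
      omega

lemma substApply_eq_appendW {σ : Bool → List Bool} (hσ : ∀ b, σ b ≠ []) (u : ℕ → Bool) :
    substApply σ u = appendW (σ (u 0)) (substApply σ (suffix 1 u)) := by
  funext n
  simp only [appendW]
  split_ifs with hn
  · simpa using substApply_sum_add σ u 0 n hn
  · obtain ⟨k, j, hj, hnk⟩ := exists_eq_sum_add hσ (suffix 1 u) (n - (σ (u 0)).length)
    have hn' : n = (∑ i ∈ Finset.range (k + 1), (σ (u i)).length) + j := by
      rw [Finset.sum_range_succ']
      simp only [suffix] at hnk
      omega
    rw [hnk, substApply_sum_add _ _ _ _ hj]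
    conv_lhs => rw [hn']
    exact substApply_sum_add σ u (k + 1) j hj

lemma appendW_nil (v : ℕ → Bool) : appendW [] v = v := by
  funext n
  simp [appendW]

lemma appendW_cons (b : Bool) (w : List Bool) (v : ℕ → Bool) :
    appendW (b :: w) v = consB b (appendW w v) := by
  funext n
  cases n <;> simp [appendW, consB]

lemma suffix_length_appendW (w : List Bool) (v : ℕ → Bool) :
    suffix w.length (appendW w v) = v := by
  funext n
  simp [suffix, appendW]

lemma appendW_agree {v v' : ℕ → Bool} {n : ℕ} (w : List Bool) (h : ∀ i < n, v i = v' i) :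
    ∀ i < w.length + n, appendW w v i = appendW w v' i := by
  intro i hi
  simp only [appendW]
  split_ifs with hw
  · rfl
  · exact h _ (by omega)

lemma lexLe.appendW {v v' : ℕ → Bool} (w : List Bool) (h : lexLe v v') :
    lexLe (appendW w v) (appendW w v') := by
  induction w with
  | nil => simpa only [appendW_nil] using h
  | cons b w ih => simpa only [appendW_cons] using ih.consB b

lemma substApply_agree {σ : Bool → List Bool} (hσ : ∀ b, σ b ≠ []) {n : ℕ} {u v : ℕ → Bool}
    (h : ∀ i < n, u i = v i) : ∀ i < n, substApply σ u i = substApply σ v i := by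
  induction n generalizing u v with
  | zero => simp
  | succ n ih =>
    intro i hi
    rw [substApply_eq_appendW hσ u, substApply_eq_appendW hσ v, h 0 (by omega)]
    have hlen : 0 < (σ (v 0)).length := List.length_pos_iff.mpr (hσ _)
    exact appendW_agree _ (ih fun i hi => h (i + 1) (by omega)) i (by omega)

lemma substApply_lexLe {σ : Bool → List Bool} (hσ : ∀ b, σ b ≠ [])
    (hhead : ∀ u v, u 0 = false → v 0 = true → lexLe (substApply σ u) (substApply σ v))
    {u v : ℕ → Bool} (h : lexLe u v) : lexLe (substApply σ u) (substApply σ v) := by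
  rcases h with ⟨n, hn, hlt⟩ | rfl
  · induction n generalizing u v with
    | zero => exact hhead u v (Bool.lt_iff.mp hlt).1 (Bool.lt_iff.mp hlt).2
    | succ n ih =>
      rw [substApply_eq_appendW hσ u, substApply_eq_appendW hσ v, hn 0 (by omega)]
      exact (ih (fun i hi => hn (i + 1) (by omega)) hlt).appendW _
  · exact Or.inr rfl

lemma substApply_suffix_mem_orbit {σ : Bool → List Bool} (hσ : ∀ b, σ b ≠ []) (u : ℕ → Bool)
    (k : ℕ) : substApply σ (suffix k u) ∈ orbit (substApply σ u) := by
  induction k with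
  | zero => exact suffix_mem_orbit 0 _
  | succ k ih =>
    obtain ⟨n, hn⟩ := ih
    refine ⟨n + (σ (suffix k u 0)).length, ?_⟩
    change _ = suffix (n + (σ (suffix k u 0)).length) (substApply σ u)
    change _ = suffix n (substApply σ u) at hn
    rw [← suffix_suffix _ n, ← hn, substApply_eq_appendW hσ (suffix k u), suffix_length_appendW,
      suffix_one_suffix]

lemma suffix_mem_orbit_of_mem {u v : ℕ → Bool} (h : v ∈ orbit u) (k : ℕ) :
    suffix k v ∈ orbit u := by
  obtain ⟨n, rfl⟩ := h
  exact ⟨n + k, suffix_suffix k n u⟩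

lemma exists_eq_suffix_of_mem_orbit {σ : Bool → List Bool} (hσ : ∀ b, σ b ≠ []) {u v : ℕ → Bool}
    (hv : v ∈ orbit (substApply σ u)) :
    ∃ k j, j < (σ (u k)).length ∧ v = suffix j (substApply σ (suffix k u)) := by
  obtain ⟨n, rfl⟩ := hv
  change ∃ k j, j < (σ (u k)).length ∧ suffix n (substApply σ u) = _
  induction n with
  | zero => exact ⟨0, 0, List.length_pos_iff.mpr (hσ _), rfl⟩
  | succ n ih =>
    obtain ⟨k, j, hj, h⟩ := ih
    rw [← suffix_one_suffix, h, suffix_one_suffix]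
    by_cases hj' : j + 1 < (σ (u k)).length
    · exact ⟨k, j + 1, hj', rfl⟩
    · refine ⟨k + 1, 0, List.length_pos_iff.mpr (hσ _), ?_⟩
      have hlen : j + 1 = (σ (suffix k u 0)).length := by
        rw [suffix_apply_zero]
        omega
      rw [hlen, substApply_eq_appendW hσ (suffix k u), suffix_length_appendW, suffix_one_suffix,
        suffix_zero]

/-! ### The substitutions `L`, `M`, `R` -/

lemma Lsub_ne_nil (b : Bool) : Lsub b ≠ [] := by cases b <;> simp [Lsub]

lemma Msub_ne_nil (b : Bool) : Msub b ≠ [] := by cases b <;> simp [Msub]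

lemma Rsub_ne_nil (b : Bool) : Rsub b ≠ [] := by cases b <;> simp [Rsub]

lemma substApply_Lsub_of_false {u : ℕ → Bool} (h : u 0 = false) :
    substApply Lsub u = consB false (substApply Lsub (suffix 1 u)) := by
  rw [substApply_eq_appendW Lsub_ne_nil, h]
  simp [Lsub, appendW_cons, appendW_nil]

lemma substApply_Lsub_of_true {u : ℕ → Bool} (h : u 0 = true) :
    substApply Lsub u = consB false (consB true (substApply Lsub (suffix 1 u))) := by
  rw [substApply_eq_appendW Lsub_ne_nil, h]
  simp [Lsub, appendW_cons, appendW_nil]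

lemma substApply_Msub_of_false {u : ℕ → Bool} (h : u 0 = false) :
    substApply Msub u = consB false (consB true (substApply Msub (suffix 1 u))) := by
  rw [substApply_eq_appendW Msub_ne_nil, h]
  simp [Msub, appendW_cons, appendW_nil]

lemma substApply_Msub_of_true {u : ℕ → Bool} (h : u 0 = true) :
    substApply Msub u = consB true (consB false (substApply Msub (suffix 1 u))) := by
  rw [substApply_eq_appendW Msub_ne_nil, h]
  simp [Msub, appendW_cons, appendW_nil]

lemma substApply_Rsub_of_false {u : ℕ → Bool} (h : u 0 = false) :
    substApply Rsub u = consB false (consB true (substApply Rsub (suffix 1 u))) := by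
  rw [substApply_eq_appendW Rsub_ne_nil, h]
  simp [Rsub, appendW_cons, appendW_nil]

lemma substApply_Rsub_of_true {u : ℕ → Bool} (h : u 0 = true) :
    substApply Rsub u = consB true (substApply Rsub (suffix 1 u)) := by
  rw [substApply_eq_appendW Rsub_ne_nil, h]
  simp [Rsub, appendW_cons, appendW_nil]

lemma substApply_Lsub_zero (u : ℕ → Bool) : substApply Lsub u 0 = false := by
  cases h : u 0 with
  | false => rw [substApply_Lsub_of_false h]; rfl
  | true => rw [substApply_Lsub_of_true h]; rfl

lemma substApply_Msub_zero (u : ℕ → Bool) : substApply Msub u 0 = u 0 := by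
  cases h : u 0 with
  | false => rw [substApply_Msub_of_false h]; rfl
  | true => rw [substApply_Msub_of_true h]; rfl

lemma substApply_Rsub_zero (u : ℕ → Bool) : substApply Rsub u 0 = u 0 := by
  cases h : u 0 with
  | false => rw [substApply_Rsub_of_false h]; rfl
  | true => rw [substApply_Rsub_of_true h]; rfl

lemma substApply_Lsub_lexLe {u v : ℕ → Bool} (h : lexLe u v) :
    lexLe (substApply Lsub u) (substApply Lsub v) := by
  refine substApply_lexLe Lsub_ne_nil (fun u v hu hv => ?_) h
  rw [substApply_Lsub_of_false hu, substApply_Lsub_of_true hv]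
  exact (lexLe_of_head (substApply_Lsub_zero _) rfl).consB _

lemma substApply_Msub_lexLe {u v : ℕ → Bool} (h : lexLe u v) :
    lexLe (substApply Msub u) (substApply Msub v) :=
  substApply_lexLe Msub_ne_nil (fun u v hu hv => lexLe_of_head
    ((substApply_Msub_zero u).trans hu) ((substApply_Msub_zero v).trans hv)) h

lemma substApply_Rsub_lexLe {u v : ℕ → Bool} (h : lexLe u v) :
    lexLe (substApply Rsub u) (substApply Rsub v) :=
  substApply_lexLe Rsub_ne_nil (fun u v hu hv => lexLe_of_head
    ((substApply_Rsub_zero u).trans hu) ((substApply_Rsub_zero v).trans hv)) h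

lemma mem_orbit_substApply_Lsub_iff {u v : ℕ → Bool} :
    v ∈ orbit (substApply Lsub u) ↔ (∃ k, v = substApply Lsub (suffix k u)) ∨
      ∃ k, u k = true ∧ v = consB true (substApply Lsub (suffix (k + 1) u)) := by
  constructor
  · intro hv
    obtain ⟨k, j, hj, rfl⟩ := exists_eq_suffix_of_mem_orbit Lsub_ne_nil hv
    cases j with
    | zero => exact Or.inl ⟨k, rfl⟩
    | succ j =>
      cases hk : u k with
      | false => simp [hk, Lsub] at hj
      | true =>
        obtain rfl : j = 0 := by simpa [hk, Lsub] using hj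
        refine Or.inr ⟨k, hk, ?_⟩
        rw [substApply_Lsub_of_true ((suffix_apply_zero k u).trans hk), suffix_one_suffix]
        rfl
  · rintro (⟨k, rfl⟩ | ⟨k, hk, rfl⟩)
    · exact substApply_suffix_mem_orbit Lsub_ne_nil u k
    · have h := suffix_mem_orbit_of_mem (substApply_suffix_mem_orbit Lsub_ne_nil u k) 1
      rwa [substApply_Lsub_of_true ((suffix_apply_zero k u).trans hk), suffix_one_suffix] at h

lemma mem_orbit_substApply_Rsub_iff {u v : ℕ → Bool} :
    v ∈ orbit (substApply Rsub u) ↔ (∃ k, v = substApply Rsub (suffix k u)) ∨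
      ∃ k, u k = false ∧ v = consB true (substApply Rsub (suffix (k + 1) u)) := by
  constructor
  · intro hv
    obtain ⟨k, j, hj, rfl⟩ := exists_eq_suffix_of_mem_orbit Rsub_ne_nil hv
    cases j with
    | zero => exact Or.inl ⟨k, rfl⟩
    | succ j =>
      cases hk : u k with
      | true => simp [hk, Rsub] at hj
      | false =>
        obtain rfl : j = 0 := by simpa [hk, Rsub] using hj
        refine Or.inr ⟨k, hk, ?_⟩
        rw [substApply_Rsub_of_false ((suffix_apply_zero k u).trans hk), suffix_one_suffix]
        rfl
  · rintro (⟨k, rfl⟩ | ⟨k, hk, rfl⟩)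
    · exact substApply_suffix_mem_orbit Rsub_ne_nil u k
    · have h := suffix_mem_orbit_of_mem (substApply_suffix_mem_orbit Rsub_ne_nil u k) 1
      rwa [substApply_Rsub_of_false ((suffix_apply_zero k u).trans hk), suffix_one_suffix] at h

lemma suffix_one_substApply_Msub (u : ℕ → Bool) (k : ℕ) :
    suffix 1 (substApply Msub (suffix k u)) =
      consB (!u k) (substApply Msub (suffix (k + 1) u)) := by
  cases hk : u k with
  | false =>
    rw [substApply_Msub_of_false ((suffix_apply_zero k u).trans hk), suffix_one_suffix]
    rfl
  | true =>
    rw [substApply_Msub_of_true ((suffix_apply_zero k u).trans hk), suffix_one_suffix]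
    rfl

lemma mem_orbit_substApply_Msub_iff {u v : ℕ → Bool} :
    v ∈ orbit (substApply Msub u) ↔ (∃ k, v = substApply Msub (suffix k u)) ∨
      ∃ k, v = consB (!u k) (substApply Msub (suffix (k + 1) u)) := by
  constructor
  · intro hv
    obtain ⟨k, j, hj, rfl⟩ := exists_eq_suffix_of_mem_orbit Msub_ne_nil hv
    have hj2 : j < 2 := by cases hk : u k <;> simpa [hk, Msub] using hj
    interval_cases j
    · exact Or.inl ⟨k, rfl⟩
    · exact Or.inr ⟨k, suffix_one_substApply_Msub u k⟩
  · rintro (⟨k, rfl⟩ | ⟨k, rfl⟩)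
    · exact substApply_suffix_mem_orbit Msub_ne_nil u k
    · rw [← suffix_one_substApply_Msub]
      exact suffix_mem_orbit_of_mem (substApply_suffix_mem_orbit Msub_ne_nil u k) 1

lemma infO_substApply_Lsub (u : ℕ → Bool) :
    infO (substApply Lsub u) = substApply Lsub (infO u) := by
  refine lexInfSeq_eq (fun v hv => ?_) fun n => ?_
  · rcases mem_orbit_substApply_Lsub_iff.mp hv with ⟨k, rfl⟩ | ⟨k, -, rfl⟩
    · exact substApply_Lsub_lexLe (infO_lexLe_suffix k u)
    · exact lexLe_of_head (substApply_Lsub_zero _) rfl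
  · obtain ⟨k, hk⟩ := exists_suffix_agree_infO u n
    exact ⟨_, substApply_suffix_mem_orbit Lsub_ne_nil u k, substApply_agree Lsub_ne_nil hk⟩

lemma infO_substApply_Rsub (u : ℕ → Bool) :
    infO (substApply Rsub u) = substApply Rsub (infO u) := by
  refine lexInfSeq_eq (fun v hv => ?_) fun n => ?_
  · rcases mem_orbit_substApply_Rsub_iff.mp hv with ⟨k, rfl⟩ | ⟨k, hk, rfl⟩
    · exact substApply_Rsub_lexLe (infO_lexLe_suffix k u)
    · exact lexLe_of_head ((substApply_Rsub_zero _).trans (infO_zero_of_apply hk)) rfl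
  · obtain ⟨k, hk⟩ := exists_suffix_agree_infO u n
    exact ⟨_, substApply_suffix_mem_orbit Rsub_ne_nil u k, substApply_agree Rsub_ne_nil hk⟩

lemma supO_w0bar : supO w0bar = w0bar :=
  lexSupSeq_eq (fun _ ⟨_, hk⟩ => Or.inr hk) fun _ => ⟨w0bar, ⟨0, rfl⟩, fun _ _ => rfl⟩

lemma consB_false_w0bar : consB false w0bar = w0bar :=
  consB_suffix_one (u := w0bar) rfl

lemma substApply_Lsub_w0bar : substApply Lsub w0bar = w0bar := by
  funext n
  induction n with
  | zero => exact substApply_Lsub_zero _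
  | succ n ih =>
    rw [substApply_Lsub_of_false rfl]
    exact ih

lemma consB_false_supO_substApply_Lsub (u : ℕ → Bool) :
    consB false (supO (substApply Lsub u)) = substApply Lsub (supO u) := by
  cases hs : supO u 0 with
  | false =>
    obtain rfl : u = w0bar := by
      funext k
      rw [w0bar, ← Bool.not_eq_true]
      intro hk
      simp [supO_zero_of_apply hk] at hs
    rw [supO_w0bar, substApply_Lsub_w0bar, supO_w0bar, consB_false_w0bar]
  | true =>
    rw [substApply_Lsub_of_true hs]
    congr 1
    refine lexSupSeq_eq (fun v hv => ?_) fun n => ?_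
    · rcases mem_orbit_substApply_Lsub_iff.mp hv with ⟨k, rfl⟩ | ⟨k, hk, rfl⟩
      · exact lexLe_of_head (substApply_Lsub_zero _) rfl
      · have h := (suffix_lexLe_supO k u).suffix_one (by rw [suffix_apply_zero, hk, hs])
        rw [suffix_one_suffix] at h
        exact (substApply_Lsub_lexLe h).consB _
    · obtain ⟨k, hk⟩ := exists_suffix_agree_supO u (n + 1)
      have huk : u k = true := by
        rw [← suffix_apply_zero k u, hk 0 (by omega), hs]
      refine ⟨_, mem_orbit_substApply_Lsub_iff.mpr (Or.inr ⟨k, huk, rfl⟩), ?_⟩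
      rw [← suffix_one_suffix]
      exact consB_agree _ (substApply_agree Lsub_ne_nil fun i hi => hk (i + 1) (by omega))

lemma infO_substApply_Msub {u : ℕ → Bool} (hu : infO u = inf1 u) :
    infO (substApply Msub u) = consB false (substApply Msub (infO u)) := by
  refine lexInfSeq_eq (fun v hv => ?_) fun n => ?_
  · rcases mem_orbit_substApply_Msub_iff.mp hv with ⟨k, rfl⟩ | ⟨k, rfl⟩
    · cases hk : u k with
      | true =>
        exact lexLe_of_head rfl (by rw [substApply_Msub_zero, suffix_apply_zero, hk])
      | false =>
        rw [substApply_Msub_of_false ((suffix_apply_zero k u).trans hk)]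
        exact (lexLe_of_head ((substApply_Msub_zero _).trans (infO_zero_of_apply hk)) rfl).consB _
    · cases hk : u k with
      | true => exact (substApply_Msub_lexLe (infO_lexLe_suffix (k + 1) u)).consB _
      | false => exact lexLe_of_head rfl rfl
  · obtain ⟨k, hk, hagree⟩ := exists_suffix_agree_of_infO_eq hu n
    refine ⟨_, mem_orbit_substApply_Msub_iff.mpr (Or.inr ⟨k, rfl⟩), ?_⟩
    rw [hk]
    exact consB_agree _ (substApply_agree Msub_ne_nil hagree)

lemma supO_substApply_Rsub {u : ℕ → Bool} (hu : supO u = sup0 u) :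
    supO (substApply Rsub u) = consB true (substApply Rsub (supO u)) := by
  refine lexSupSeq_eq (fun v hv => ?_) fun n => ?_
  · rcases mem_orbit_substApply_Rsub_iff.mp hv with ⟨k, rfl⟩ | ⟨k, -, rfl⟩
    · cases hk : u k with
      | false =>
        exact lexLe_of_head (by rw [substApply_Rsub_zero, suffix_apply_zero, hk]) rfl
      | true =>
        rw [substApply_Rsub_of_true ((suffix_apply_zero k u).trans hk), suffix_one_suffix]
        exact (substApply_Rsub_lexLe (suffix_lexLe_supO (k + 1) u)).consB _
    · exact (substApply_Rsub_lexLe (suffix_lexLe_supO (k + 1) u)).consB _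
  · obtain ⟨k, hk, hagree⟩ := exists_suffix_agree_of_supO_eq hu n
    exact ⟨_, mem_orbit_substApply_Rsub_iff.mpr (Or.inr ⟨k, hk, rfl⟩),
      consB_agree _ (substApply_agree Rsub_ne_nil hagree)⟩

lemma supO_substApply_Msub {u : ℕ → Bool} (hu : supO u = sup0 u) :
    supO (substApply Msub u) = consB true (substApply Msub (supO u)) := by
  refine lexSupSeq_eq (fun v hv => ?_) fun n => ?_
  · rcases mem_orbit_substApply_Msub_iff.mp hv with ⟨k, rfl⟩ | ⟨k, rfl⟩
    · cases hk : u k with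
      | false =>
        exact lexLe_of_head (by rw [substApply_Msub_zero, suffix_apply_zero, hk]) rfl
      | true =>
        rw [substApply_Msub_of_true ((suffix_apply_zero k u).trans hk)]
        exact (lexLe_of_head rfl ((substApply_Msub_zero _).trans (supO_zero_of_apply hk))).consB _
    · cases hk : u k with
      | false => exact (substApply_Msub_lexLe (suffix_lexLe_supO (k + 1) u)).consB _
      | true => exact lexLe_of_head rfl rfl
  · obtain ⟨k, hk, hagree⟩ := exists_suffix_agree_of_supO_eq hu n
    refine ⟨_, mem_orbit_substApply_Msub_iff.mpr (Or.inr ⟨k, rfl⟩), ?_⟩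
    rw [hk]
    exact consB_agree _ (substApply_agree Msub_ne_nil hagree)


/-- Behaviour of `inf O` and `sup O` under the substitutions `L`, `M`, `R`. -/
theorem infO_supO_subst (u : ℕ → Bool) :
    infO (substApply Lsub u) = substApply Lsub (infO u) ∧
    infO (substApply Rsub u) = substApply Rsub (infO u) ∧
    consB false (supO (substApply Lsub u)) = substApply Lsub (supO u) ∧
    (infO u = inf1 u →
      infO (substApply Msub u) = consB false (substApply Msub (infO u))) ∧
    (supO u = sup0 u →
      supO (substApply Rsub u) = consB true (substApply Rsub (supO u)) ∧
      supO (substApply Msub u) = consB true (substApply Msub (supO u))) := by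
  exact ⟨infO_substApply_Lsub u, infO_substApply_Rsub u, consB_false_supO_substApply_Lsub u,
    infO_substApply_Msub, fun h => ⟨supO_substApply_Rsub h, supO_substApply_Msub h⟩⟩
end
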